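/- The series G(s) := Σ_{n=2}^∞ (n + 1/log n)^{−s} converges absolutely and defines a holomorphic function on the half-plane {s ∈ ℂ : Re s > 1}, and G admits no meromorphic continuation to the complex plane: there is no function h that is meromorphic on all of ℂ and satisfies h(s) = G(s) for every s with Re s > 1. -/

import Mathlib

noncomputable section

/-- The term `(n + 1/log n)^{−s}` (for `n ≥ 2`, indexed by `n - 2`), where
`x^{−s} := exp(−s · log x)` with the real logarithm of `x = n + 1/log n > 0`. -/
def Gterm (s : ℂ) (n : ℕ) : ℂ :=
  Complex.exp (-s * (Real.log (((n : ℝ) + 2) + 1 / Real.log ((n : ℝ) + 2)) : ℂ))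

/-- `G(s) = Σ_{n=2}^∞ (n + 1/log n)^{−s}`. -/
def Gfun (s : ℂ) : ℂ := ∑' n : ℕ, Gterm s n

open Complex Filter Topology LSeries ZetaAsymptotics

/-- Second-order Taylor bound for `(1 + t)^{-s}` on `0 ≤ t ≤ 1`. -/
lemma norm_exp_neg_mul_log_one_add_sub_le (s : ℂ) {t : ℝ} (h0 : 0 ≤ t) (h1 : t ≤ 1) :
    ‖exp (-s * (Real.log (1 + t) : ℂ)) - 1 + s * t‖ ≤
      (‖s‖ ^ 2 * Real.exp ‖s‖ + ‖s‖) * t ^ 2 := by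
  set u := Real.log (1 + t)
  have hu0 : 0 ≤ u := Real.log_nonneg (by linarith)
  have hut : u ≤ t := by
    have := Real.log_le_sub_one_of_pos (show 0 < 1 + t by linarith)
    linarith
  have hlow : t - t ^ 2 ≤ u := by
    have h := Real.one_sub_inv_le_log_of_pos (show 0 < 1 + t by linarith)
    have h' : t - t ^ 2 ≤ 1 - (1 + t)⁻¹ := by
      have hpos : 0 < 1 + t := by linarith
      have : 1 - (1 + t)⁻¹ - (t - t ^ 2) = t ^ 3 * (1 + t)⁻¹ := by field_simp; ring
      have : 0 ≤ t ^ 3 * (1 + t)⁻¹ := by positivity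
      linarith
    linarith
  have hnorm : ‖-s * (u : ℂ)‖ = ‖s‖ * u := by
    rw [norm_mul, norm_neg, Complex.norm_real, Real.norm_of_nonneg hu0]
  have hexp : ‖exp (-s * (u : ℂ)) - 1 - (-s * u)‖ ≤ ‖s‖ ^ 2 * Real.exp ‖s‖ * t ^ 2 := by
    have h := Complex.norm_exp_sub_sum_le_norm_mul_exp (-s * (u : ℂ)) 2
    rw [Finset.sum_range_succ, Finset.sum_range_one, pow_zero, pow_one, Nat.factorial_zero,
      Nat.factorial_one, Nat.cast_one, div_one, div_one, ← sub_sub, hnorm, mul_pow] at h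
    refine h.trans ?_
    have : ‖s‖ * u ≤ ‖s‖ := mul_le_of_le_one_right (norm_nonneg s) (hut.trans h1)
    calc ‖s‖ ^ 2 * u ^ 2 * Real.exp (‖s‖ * u) ≤ ‖s‖ ^ 2 * t ^ 2 * Real.exp ‖s‖ := by gcongr
      _ = _ := by ring
  have hlin : ‖s * ((t : ℂ) - u)‖ ≤ ‖s‖ * t ^ 2 := by
    rw [norm_mul, ← Complex.ofReal_sub, Complex.norm_real, Real.norm_of_nonneg (by linarith)]
    gcongr
    linarith
  calc ‖exp (-s * (u : ℂ)) - 1 + s * t‖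
      = ‖(exp (-s * (u : ℂ)) - 1 - (-s * u)) + s * ((t : ℂ) - u)‖ := by congr 1; ring
    _ ≤ _ := norm_add_le _ _
    _ ≤ _ := by rw [add_mul]; exact add_le_add hexp hlin

/-- The coefficients `1 / log n`. -/
def invLog (n : ℕ) : ℂ := ((Real.log n)⁻¹ : ℝ)

lemma inv_log_le_two {n : ℕ} (hn : 2 ≤ n) : (Real.log n)⁻¹ ≤ 2 := by
  have h2 : (1 / 2 : ℝ) ≤ Real.log 2 := by linarith [Real.log_two_gt_d9]
  have h3 : Real.log 2 ≤ Real.log n := Real.log_le_log (by norm_num) (by exact_mod_cast hn)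
  calc (Real.log n)⁻¹ ≤ (1 / 2 : ℝ)⁻¹ := inv_anti₀ (by norm_num) (h2.trans h3)
    _ = 2 := by norm_num

lemma norm_invLog_le (n : ℕ) : ‖invLog n‖ ≤ 2 := by
  rw [invLog, Complex.norm_real, Real.norm_of_nonneg (inv_nonneg.2 (Real.log_natCast_nonneg n))]
  obtain hn | hn := le_or_gt 2 n
  · exact inv_log_le_two hn
  · interval_cases n <;> simp

lemma abscissaOfAbsConv_invLog_le : abscissaOfAbsConv invLog ≤ 1 :=
  abscissaOfAbsConv_le_of_le_const ⟨2, fun n _ ↦ norm_invLog_le n⟩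

lemma abscissaOfAbsConv_invLog_lt {s : ℂ} (hs : 1 < s.re) : abscissaOfAbsConv invLog < s.re :=
  abscissaOfAbsConv_invLog_le.trans_lt (by exact_mod_cast hs)

lemma logMul_invLog_of_two_le {n : ℕ} (hn : 2 ≤ n) : logMul invLog n = 1 := by
  have : Real.log n ≠ 0 := (Real.log_pos (by exact_mod_cast hn)).ne'
  rw [logMul, invLog, ← Complex.natCast_log, ← Complex.ofReal_mul, mul_inv_cancel₀ this,
    Complex.ofReal_one]

lemma LSeries_logMul_invLog {s : ℂ} (hs : 1 < s.re) :
    LSeries (logMul invLog) s = riemannZeta s - 1 := by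
  have h : ∀ {n : ℕ}, n ≠ 0 → logMul invLog n = ((1 : ℕ → ℂ) - delta) n := by
    intro n hn
    obtain h2 | h2 := le_or_gt 2 n
    · rw [logMul_invLog_of_two_le h2]
      simp [delta, show n ≠ 1 by omega]
    · obtain rfl : n = 1 := by omega
      simp [logMul, delta]
  have hδ : LSeriesSummable delta s := by
    refine summable_of_ne_finset_zero (s := {1}) fun n hn ↦ ?_
    rw [term_delta, if_neg (by simpa using hn)]
  rw [LSeries_congr h, LSeries_sub (LSeriesSummable_one_iff.2 hs) hδ,
    LSeries_one_eq_riemannZeta hs, LSeries_delta, Pi.one_apply]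

lemma hasSum_term_add_two {f : ℕ → ℂ} {s : ℂ} (h1 : f 1 = 0) (hf : LSeriesSummable f s) :
    HasSum (fun n ↦ term f s (n + 2)) (LSeries f s) := by
  refine (hasSum_nat_add_iff 2).2 ?_
  simpa [Finset.sum_range_succ, term_of_ne_zero, h1, LSeriesHasSum] using hf.LSeriesHasSum

/-- The error of the first-order expansion of `(n + 1 / log n)^{-s}`, for `n + 2` in place
of `n`. -/
def remainderTerm (s : ℂ) (n : ℕ) : ℂ :=
  Gterm s n - term (logMul invLog) s (n + 2) + s * term invLog (s + 1) (n + 2)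

lemma natCast_cpow_eq_exp {n : ℕ} (hn : n ≠ 0) (s : ℂ) :
    (n : ℂ) ^ s = exp ((Real.log n : ℂ) * s) := by
  rw [Complex.cpow_def_of_ne_zero (by exact_mod_cast hn), Complex.natCast_log]

lemma remainderTerm_eq (s : ℂ) (n : ℕ) :
    remainderTerm s n = ((n + 2 : ℕ) : ℂ) ^ (-s) *
      (exp (-s * (Real.log (1 + (Real.log (n + 2 : ℕ))⁻¹ / (n + 2 : ℕ)) : ℂ)) - 1 +
        s * ((Real.log (n + 2 : ℕ))⁻¹ / (n + 2 : ℕ) : ℝ)) := by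
  have hN : 2 ≤ n + 2 := by omega
  have hG : Gterm s n = exp (-s * (Real.log ((n + 2 : ℕ) + (Real.log (n + 2 : ℕ))⁻¹) : ℂ)) := by
    simp [Gterm]
  rw [remainderTerm, hG, term_of_ne_zero (by omega), term_of_ne_zero (by omega),
    logMul_invLog_of_two_le hN]
  generalize n + 2 = N at hN
  have hN0 : N ≠ 0 := by omega
  have hNpos : (0 : ℝ) < N := by exact_mod_cast hN0.bot_lt
  have hlog : 0 < Real.log N := Real.log_pos (by exact_mod_cast hN)
  have hfac : Real.log (N + (Real.log N)⁻¹) =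
      Real.log N + Real.log (1 + (Real.log N)⁻¹ / N) := by
    rw [← Real.log_mul hNpos.ne' (by positivity)]
    congr 1
    field_simp
  have hNC : (N : ℂ) ≠ 0 := by exact_mod_cast hN0
  rw [hfac, Complex.ofReal_add, mul_add, Complex.exp_add, Complex.cpow_add _ _ hNC,
    Complex.cpow_one, Complex.cpow_neg, natCast_cpow_eq_exp hN0, invLog, Complex.ofReal_div,
    Complex.ofReal_natCast, neg_mul s (Real.log N : ℂ), Complex.exp_neg,
    mul_comm s (Real.log N : ℂ)]
  have := Complex.exp_ne_zero ((Real.log N : ℂ) * s)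
  field_simp

lemma norm_remainderTerm_le (s : ℂ) (n : ℕ) :
    ‖remainderTerm s n‖ ≤
      4 * (‖s‖ ^ 2 * Real.exp ‖s‖ + ‖s‖) * ((n + 2 : ℕ) : ℝ) ^ (-s.re - 2) := by
  rw [remainderTerm_eq]
  have hN : 2 ≤ n + 2 := by omega
  generalize n + 2 = N at hN
  have hN2 : (2 : ℝ) ≤ N := by exact_mod_cast hN
  have hNpos : (0 : ℝ) < N := by linarith
  have hlog : 0 < Real.log N := Real.log_pos (by linarith)
  have ht : (Real.log N)⁻¹ / N ≤ 2 / N := by gcongr; exact inv_log_le_two hN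
  have ht1 : 2 / (N : ℝ) ≤ 1 := (div_le_one hNpos).2 hN2
  rw [norm_mul, Complex.norm_natCast_cpow_of_pos (by omega), Complex.neg_re,
    Real.rpow_sub hNpos, Real.rpow_two]
  calc (N : ℝ) ^ (-s.re) * _
      ≤ (N : ℝ) ^ (-s.re) * ((‖s‖ ^ 2 * Real.exp ‖s‖ + ‖s‖) * (2 / N) ^ 2) := by
        gcongr
        refine (norm_exp_neg_mul_log_one_add_sub_le s (by positivity) (ht.trans ht1)).trans ?_
        gcongr
    _ = _ := by field_simp; ring

lemma summable_natCast_add_two_rpow {a : ℝ} (ha : -1 < a) :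
    Summable fun n : ℕ ↦ ((n + 2 : ℕ) : ℝ) ^ (-a - 2) :=
  (summable_nat_add_iff (f := fun n : ℕ ↦ (n : ℝ) ^ (-a - 2)) 2).2
    (Real.summable_nat_rpow.2 (by linarith))

lemma summable_remainderTerm {s : ℂ} (hs : -1 < s.re) : Summable (remainderTerm s) :=
  .of_norm_bounded ((summable_natCast_add_two_rpow hs).mul_left _) (norm_remainderTerm_le s)

/-- The sum of the errors of the first-order expansions. -/
def remainder (s : ℂ) : ℂ := ∑' n, remainderTerm s n

lemma differentiable_remainderTerm (n : ℕ) : Differentiable ℂ fun s ↦ remainderTerm s n := by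
  have h (f : ℕ → ℂ) : Differentiable ℂ fun s ↦ term f s (n + 2) :=
    fun s ↦ (hasDerivAt_term f (n + 2) s).differentiableAt
  have h1 : Differentiable ℂ fun s ↦ term invLog (s + 1) (n + 2) :=
    (h invLog).comp (differentiable_id.add_const 1)
  have h2 := h (logMul invLog)
  unfold remainderTerm Gterm
  fun_prop

lemma differentiableAt_remainder {s : ℂ} (hs : -1 < s.re) : DifferentiableAt ℂ remainder s := by
  obtain ⟨a, ha, has⟩ := exists_between hs
  set V : Set ℂ := {z | a < z.re} ∩ Metric.ball 0 (‖s‖ + 1)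
  have hV : IsOpen V := (isOpen_lt continuous_const Complex.continuous_re).inter Metric.isOpen_ball
  have hsV : s ∈ V := ⟨has, by simp⟩
  refine (differentiableOn_tsum_of_summable_norm (u := fun n ↦
    4 * ((‖s‖ + 1) ^ 2 * Real.exp (‖s‖ + 1) + (‖s‖ + 1)) * ((n + 2 : ℕ) : ℝ) ^ (-a - 2))
    ((summable_natCast_add_two_rpow ha).mul_left _)
    (fun n ↦ (differentiable_remainderTerm n).differentiableOn) hV
    fun n w hw ↦ (norm_remainderTerm_le w n).trans ?_).differentiableAt (hV.mem_nhds hsV)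
  have hw1 : ‖w‖ ≤ ‖s‖ + 1 := (mem_ball_zero_iff.1 hw.2).le
  have hw2 : a ≤ w.re := hw.1.le
  gcongr
  exact_mod_cast (by omega : 1 ≤ n + 2)

lemma hasSum_Gterm {s : ℂ} (hs : 1 < s.re) :
    HasSum (Gterm s) (riemannZeta s - 1 - s * LSeries invLog (s + 1) + remainder s) := by
  have hs1 : 1 < (s + 1).re := by simp; linarith
  have h1 := hasSum_term_add_two (by simp [logMul])
    (LSeriesSummable_logMul_of_lt_re (abscissaOfAbsConv_invLog_lt hs))
  have h2 := hasSum_term_add_two (f := invLog) (by simp [invLog])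
    (LSeriesSummable_of_abscissaOfAbsConv_lt_re (abscissaOfAbsConv_invLog_lt hs1))
  rw [LSeries_logMul_invLog hs] at h1
  have h3 : HasSum (remainderTerm s) (remainder s) :=
    (summable_remainderTerm (by linarith)).hasSum
  have hterm : Gterm s = fun n ↦ term (logMul invLog) s (n + 2) -
      s * term invLog (s + 1) (n + 2) + remainderTerm s n := by
    funext n
    rw [remainderTerm]
    ring
  rw [hterm]
  exact (h1.sub (h2.mul_left s)).add h3

lemma hasDerivAt_LSeries_invLog_add_one {s : ℂ} (hs : 0 < s.re) :
    HasDerivAt (fun z ↦ LSeries invLog (z + 1)) (1 - riemannZeta (s + 1)) s := by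
  have hs1 : 1 < (s + 1).re := by simpa using hs
  have h := LSeries_hasDerivAt (abscissaOfAbsConv_invLog_lt hs1)
  rw [LSeries_logMul_invLog hs1, neg_sub] at h
  exact h.comp_add_const s 1

/-- The derivative of a meromorphic function has no simple pole. -/
lemma meromorphicOrderAt_deriv_ne_neg_one {f : ℂ → ℂ} {x : ℂ} (hf : MeromorphicAt f x) :
    meromorphicOrderAt (deriv f) x ≠ (-1 : ℤ) := by
  by_cases h : 0 ≤ meromorphicOrderAt f x
  · obtain ⟨g, hg, hfg⟩ := hf.meromorphicOrderAt_nonneg_iff.1 h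
    rw [meromorphicOrderAt_congr hfg.nhdsNE_deriv]
    intro h'
    have := hg.deriv.meromorphicOrderAt_nonneg
    rw [h'] at this
    exact absurd this (by decide)
  · lift meromorphicOrderAt f x to ℤ using (by rintro h'; simp [h'] at h) with n hn
    have hn0 : n < 0 := by exact_mod_cast not_le.1 h
    rw [meromorphicOrderAt_deriv_eq_sub_one (by exact_mod_cast hn0.ne) hn.symm]
    intro h'
    have : n - 1 = -1 := by exact_mod_cast h'
    omega

lemma not_exists_meromorphicOn_eq_Gfun :
    ¬ ∃ h : ℂ → ℂ, MeromorphicOn h Set.univ ∧ ∀ s : ℂ, 1 < s.re → h s = Gfun s := by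
  rintro ⟨h, hh, hG⟩
  set A : ℂ → ℂ := fun s ↦ ((s - 1)⁻¹ + riemannZeta₀ s - 1 + remainder s - h s) / s with hA
  set U : Set ℂ := {s | -1 < s.re} with hU
  have hUo : IsOpen U := isOpen_lt continuous_const Complex.continuous_re
  have hUc : IsPreconnected U := (convex_halfSpace_re_gt (-1)).isPreconnected
  have hAm (s : ℂ) (hs : s ∈ U) : MeromorphicAt A s := by
    have h1 : MeromorphicAt remainder s :=
      (DifferentiableOn.analyticAt
        (fun z hz ↦ (differentiableAt_remainder hz).differentiableWithinAt)
        (hUo.mem_nhds hs)).meromorphicAt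
    have h2 : MeromorphicAt riemannZeta₀ s :=
      (differentiable_riemannZeta₀.analyticAt s).meromorphicAt
    have h3 : MeromorphicAt h s := hh s trivial
    fun_prop
  have hζ (s : ℂ) : AnalyticAt ℂ (fun z ↦ riemannZeta₀ (z + 1)) s :=
    Differentiable.analyticAt (by fun_prop) s
  set D : ℂ → ℂ := fun s ↦ deriv A s + s⁻¹ + riemannZeta₀ (s + 1) - 1 with hD
  have hDm : MeromorphicOn D U := fun s hs ↦ by
    have h1 := (hAm s hs).deriv
    have h2 := (hζ s).meromorphicAt
    fun_prop
  have hAF (s : ℂ) (hs : 1 < s.re) : A s = LSeries invLog (s + 1) := by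
    have hs0 : s ≠ 0 := by rintro rfl; norm_num at hs
    have hs1 : s ≠ 1 := by rintro rfl; norm_num at hs
    rw [hA]
    simp only
    rw [hG s hs, Gfun, (hasSum_Gterm hs).tsum_eq, ← riemannZeta_eq_inv_sub_add hs1]
    field_simp
    ring
  have hD2 : meromorphicOrderAt D 2 = ⊤ := by
    refine meromorphicOrderAt_eq_top_iff.2 (Filter.Eventually.filter_mono nhdsWithin_le_nhds ?_)
    have hW : IsOpen {s : ℂ | 1 < s.re} := isOpen_lt continuous_const Complex.continuous_re
    filter_upwards [hW.mem_nhds (show (2 : ℂ) ∈ {s : ℂ | 1 < s.re} by norm_num)] with s hs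
    have hs : 1 < s.re := hs
    have hs0 : s + 1 ≠ 1 := by
      intro h0
      have := congrArg Complex.re h0
      simp at this
      linarith
    have hder : deriv A s = 1 - riemannZeta (s + 1) := by
      rw [← (hasDerivAt_LSeries_invLog_add_one (by linarith : 0 < s.re)).deriv]
      refine Filter.EventuallyEq.deriv_eq ?_
      filter_upwards [hW.mem_nhds hs] with z hz using hAF z hz
    rw [hD]
    simp only
    rw [hder, riemannZeta_eq_inv_sub_add hs0, add_sub_cancel_right]
    ring
  have h0U : (0 : ℂ) ∈ U := by simp [hU]
  have hD0 : meromorphicOrderAt D 0 = ⊤ := by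
    by_contra h0
    exact hDm.meromorphicOrderAt_ne_top_of_isPreconnected hUc h0U (by norm_num [hU]) h0 hD2
  refine meromorphicOrderAt_deriv_ne_neg_one (hAm 0 h0U)
    ((meromorphicOrderAt_eq_int_iff (hAm 0 h0U).deriv).2
      ⟨fun s ↦ -1 + s * (1 - riemannZeta₀ (s + 1)), ?_, by simp, ?_⟩)
  · have := hζ 0
    fun_prop
  · filter_upwards [meromorphicOrderAt_eq_top_iff.1 hD0, self_mem_nhdsWithin] with s hs hs0
    have hs0 : s ≠ 0 := hs0
    have hs : deriv A s + s⁻¹ + riemannZeta₀ (s + 1) - 1 = 0 := hs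
    rw [sub_zero, zpow_neg_one, smul_eq_mul, mul_add, inv_mul_cancel_left₀ hs0]
    linear_combination hs

/-- The series `G(s) = Σ_{n=2}^∞ (n + 1/log n)^{−s}` converges
absolutely and defines a holomorphic function on `{Re s > 1}`, and `G` admits no
meromorphic continuation to the complex plane: there is no `h` meromorphic on all of
`ℂ` with `h(s) = G(s)` for every `s` with `Re s > 1`. -/
theorem stmt17 :
    (∀ s : ℂ, 1 < s.re → Summable fun n : ℕ => ‖Gterm s n‖) ∧
    DifferentiableOn ℂ Gfun {s : ℂ | 1 < s.re} ∧
    ¬ ∃ h : ℂ → ℂ, MeromorphicOn h Set.univ ∧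
      ∀ s : ℂ, 1 < s.re → h s = Gfun s := by
  refine ⟨fun s hs ↦ (hasSum_Gterm hs).summable.norm, ?_, not_exists_meromorphicOn_eq_Gfun⟩
  refine DifferentiableOn.congr (fun s hs ↦ DifferentiableAt.differentiableWithinAt ?_)
    fun s hs ↦ (hasSum_Gterm hs).tsum_eq
  have hs : 1 < s.re := hs
  have h1 : DifferentiableAt ℂ riemannZeta s :=
    differentiableAt_riemannZeta (by rintro rfl; norm_num at hs)
  have h2 := (hasDerivAt_LSeries_invLog_add_one (by linarith : 0 < s.re)).differentiableAt
  have h3 := differentiableAt_remainder (by linarith : -1 < s.re)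
  fun_prop

end
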